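/- Let E be a framed Ĥ_n-invariant representation of A_{n-1}^{⊗n} supported over vertices with indices 0,…,n-1, with framing isomorphisms φ, and fix vertices a_0,…,a_{n-1} with λ(a_i) = i. For each label c ∈ {1,…,n} and each 0 ≤ i ≤ n-2 define G(E)^c_{i,i+1} := φ_{b,a_{i+1}} ∘ E_{a,b} ∘ φ_{a_i,a} : E_{a_i} → E_{a_{i+1}}, where a → b is any arrow with λ(a) = i and λ(a,b) = c (this is independent of the choice of such an arrow). Then for all labels c, c' ∈ {1,…,n} and all 1 ≤ i ≤ n-2, one has G(E)^{c'}_{i,i+1} ∘ G(E)^c_{i-1,i} = G(E)^c_{i,i+1} ∘ G(E)^{c'}_{i-1,i}; that is, G(E) is a representation of the Beilinson quiver B_{n-1} with its commuting relations. -/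

import Mathlib

/-!
Statement 0.  Setting: the quiver `A_{n-1}^{⊗ n}`.
Vertices are functions `a : Fin n → Fin n` (the `n` coordinates, each taking the
values `0, …, n-1`), the index of a vertex is `lam a = ∑ i, a i`, and there is an
arrow `a → b` with label `j` iff `b` increases the `j`-th coordinate of `a` by one
and agrees with `a` elsewhere.  Possibly degenerate arrows are encoded with labels
in `Option (Fin n)`: the label `none` stands for the degenerate arrow `a → a`
(the label `λ(a,a) = 0` of the paper).
-/

/-- Vertices of the quiver `A_{n-1}^{⊗ n}`. -/
abbrev Vtx (n : ℕ) := Fin n → Fin n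

/-- The index `λ(a) = ∑ i, a i` of a vertex. -/
def lam {n : ℕ} (a : Vtx n) : ℕ := ∑ i, (a i : ℕ)

/-- `IsArrow a b j`: there is a (non-degenerate) arrow `a → b` with label
`λ(a,b) = j`. -/
def IsArrow {n : ℕ} (a b : Vtx n) (j : Fin n) : Prop :=
  ((b j : ℕ) = (a j : ℕ) + 1) ∧ ∀ i, i ≠ j → b i = a i

/-- Possibly degenerate arrows, with the degenerate arrow `a → a` labelled by
`none`. -/
def HasArrow {n : ℕ} (a b : Vtx n) : Option (Fin n) → Prop
  | none => a = b
  | some j => IsArrow a b j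

theorem aux_coord_le {n : ℕ} (a : Vtx n) (j : Fin n) : (a j : ℕ) ≤ lam a := by
  unfold lam
  exact Finset.single_le_sum (f := fun i => (a i : ℕ)) (fun _ _ => Nat.zero_le _)
    (Finset.mem_univ j)

theorem aux_lam {n : ℕ} {a b : Vtx n} {j : Fin n} (h : IsArrow a b j) :
    lam b = lam a + 1 := by
  unfold lam
  rw [← Finset.add_sum_erase _ _ (Finset.mem_univ j),
    ← Finset.add_sum_erase (Finset.univ) (fun i => (a i : ℕ)) (Finset.mem_univ j), h.1]
  rw [Finset.sum_congr rfl (fun i hi => by rw [h.2 i (Finset.ne_of_mem_erase hi)])]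
  omega

theorem aux_ex {n : ℕ} (a : Vtx n) (j : Fin n) (h : lam a + 1 < n) :
    ∃ b, IsArrow a b j := by
  have := aux_coord_le a j
  refine ⟨Function.update a j ⟨(a j : ℕ) + 1, by omega⟩, by simp, ?_⟩
  intro i hi
  simp [hi]

theorem aux_sq {n : ℕ} {p q r d : Vtx n} {c c' : Fin n} (h1 : IsArrow p q c)
    (h2 : IsArrow q d c') (h3 : IsArrow p r c') : IsArrow r d c := by
  by_cases hc : c = c'
  · subst hc
    have : q = r := by
      funext k
      by_cases hk : k = c
      · subst hk; apply Fin.ext; rw [h1.1, h3.1]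
      · rw [h1.2 k hk, h3.2 k hk]
    subst this
    exact h2
  · refine ⟨?_, ?_⟩
    · rw [h2.2 c hc, h1.1, h3.2 c hc]
    · intro k hk
      by_cases hk' : k = c'
      · subst hk'; apply Fin.ext; rw [h2.1, h3.1, h1.2 k hk]
      · rw [h2.2 k hk', h1.2 k hk, h3.2 k hk']

/-- Let `E` be a framed `Ĥₙ`-invariant representation of
`A_{n-1}^{⊗ n}` supported over vertices with indices `0, …, n-1`, and fix vertices
`a i` with `λ(a i) = i`.  For an arrow `p → q` with `λ(p) = i` and label `c`, write
`G(E)^c_{i,i+1} := φ_{q, a_{i+1}} ∘ E_{p,q} ∘ φ_{a_i, p} : E_{a_i} → E_{a_{i+1}}`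
(this is independent of the choice of the arrow, which is reflected below by
quantifying over all choices of realizing arrows).  Then for all labels `c, c'`
and all `1 ≤ i ≤ n-2`,
`G(E)^{c'}_{i,i+1} ∘ G(E)^c_{i-1,i} = G(E)^c_{i,i+1} ∘ G(E)^{c'}_{i-1,i}`,
i.e. `G(E)` is a representation of the Beilinson quiver `B_{n-1}` with its
commuting relations. -/
theorem stmt4 (n : ℕ) (hn : 3 ≤ n)
    (V : Vtx n → Type) [∀ a, AddCommGroup (V a)] [∀ a, Module ℂ (V a)]
    [∀ a, FiniteDimensional ℂ (V a)]
    (E : ∀ a b : Vtx n, V a →ₗ[ℂ] V b)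
    (hEid : ∀ a : Vtx n, E a a = LinearMap.id)
    (hEcomm : ∀ (p q r s : Vtx n) (j j' : Option (Fin n)),
      HasArrow p q j → HasArrow r s j → HasArrow p r j' → HasArrow q s j' →
      (E q s).comp (E p q) = (E r s).comp (E p r))
    (φ : ∀ a b : Vtx n, V a →ₗ[ℂ] V b)
    (hφbij : ∀ a b : Vtx n, lam a = lam b → Function.Bijective (φ a b))
    (hφ : ∀ (a a' b c c' : Vtx n) (j : Option (Fin n)),
      HasArrow a a' j → HasArrow c c' j → lam a = lam b → lam b = lam c →
      (φ a' c').comp (E a a') = ((E c c').comp (φ b c)).comp (φ a b))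
    -- `E` is supported over vertices with indices `0, …, n-1`:
    (hsupp : ∀ b : Vtx n, n ≤ lam b → ∀ v : V b, v = 0)
    -- the fixed vertices `a_0, …, a_{n-1}`:
    (a : Fin n → Vtx n) (ha : ∀ i : Fin n, lam (a i) = (i : ℕ)) :
    ∀ (c c' : Fin n) (i : ℕ), 1 ≤ i → i ≤ n - 2 →
      ∀ (h0 : i - 1 < n) (h1 : i < n) (h2 : i + 1 < n),
      -- `p → q` realizes `G(E)^c_{i-1,i}`, `u → w` realizes `G(E)^{c'}_{i-1,i}`,
      -- `r → s` realizes `G(E)^{c'}_{i,i+1}`, `x → y` realizes `G(E)^c_{i,i+1}`: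
      ∀ (p q u w : Vtx n), lam p = i - 1 → IsArrow p q c →
        lam u = i - 1 → IsArrow u w c' →
      ∀ (r s x y : Vtx n), lam r = i → IsArrow r s c' →
        lam x = i → IsArrow x y c →
      ((((φ s (a ⟨i + 1, h2⟩)).comp (E r s)).comp (φ (a ⟨i, h1⟩) r)).comp
        (((φ q (a ⟨i, h1⟩)).comp (E p q)).comp (φ (a ⟨i - 1, h0⟩) p))) =
      ((((φ y (a ⟨i + 1, h2⟩)).comp (E x y)).comp (φ (a ⟨i, h1⟩) x)).comp
        (((φ w (a ⟨i, h1⟩)).comp (E u w)).comp (φ (a ⟨i - 1, h0⟩) u))) := by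
  have hcomp : ∀ a b c : Vtx n, lam a = lam b → lam b = lam c →
      ∀ v, φ b c (φ a b v) = φ a c v := by
    intro a b c h h' v
    have := LinearMap.congr_fun (hφ a a b c c none rfl rfl h h') v
    simpa [hEid] using this.symm
  have hid : ∀ (a : Vtx n) v, φ a a v = v := fun a v =>
    (hφbij a a rfl).1 (hcomp a a a rfl rfl v)
  have hnat : ∀ (a a' c c' : Vtx n) (j : Fin n), IsArrow a a' j → IsArrow c c' j →
      lam a = lam c → ∀ v, φ a' c' (E a a' v) = E c c' (φ a c v) := by
    intro a a' c c' j h h' hl v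
    have := LinearMap.congr_fun (hφ a a' a c c' (some j) h h' rfl hl) v
    simpa [hid] using this
  -- independence of the realizing arrow
  have hind : ∀ (p q p' q' A B : Vtx n) (j : Fin n), IsArrow p q j → IsArrow p' q' j →
      lam A = lam p → lam A = lam p' → lam B = lam p + 1 → ∀ v,
      φ q B (E p q (φ A p v)) = φ q' B (E p' q' (φ A p' v)) := by
    intro p q p' q' A B j h h' hA hA' hB v
    have e1 := aux_lam h
    have e2 := aux_lam h'
    rw [← hcomp A p p' hA (by omega) v, ← hnat p q p' q' j h h' (by omega),
      hcomp q q' B (by omega) (by omega)]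
  intro c c' i hi1 hi2 h0 h1 h2 p q u w hp hpq hu huw r s x y hr hrs hx hxy
  have l0 := ha ⟨i - 1, h0⟩
  have l1 := ha ⟨i, h1⟩
  have l2 := ha ⟨i + 1, h2⟩
  simp only at l0 l1 l2
  have lq := aux_lam hpq
  obtain ⟨d, hqd⟩ := aux_ex q c' (by omega)
  obtain ⟨t, hpt⟩ := aux_ex p c' (by omega)
  have htd := aux_sq hpq hqd hpt
  have lt := aux_lam hpt
  have key := hEcomm p q t d (some c) (some c') hpq htd hpt hqd
  ext v
  simp only [LinearMap.comp_apply]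
  rw [hind r s q d _ _ c' hrs hqd (by omega) (by omega) (by omega),
    hind x y t d _ _ c hxy htd (by omega) (by omega) (by omega),
    hind u w p t _ _ c' huw hpt (by omega) (by omega) (by omega),
    hcomp q _ q (by omega) (by omega), hcomp t _ t (by omega) (by omega), hid, hid]
  have := LinearMap.congr_fun key (φ (a ⟨i - 1, h0⟩) p v)
  simp only [LinearMap.comp_apply] at this
  rw [this]
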